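/- arXiv:1209.0921 — 6 statements merged into one kernel-verified Lean document; each statement's English description precedes it below -/
import Mathlib

section
/- (WAY theorem, repeatability version, finite dimensions.) Let d, a be positive integers. Let L and N_S be Hermitian d×d complex matrices, N_A a Hermitian a×a complex matrix, and V a unitary (d·a)×(d·a) complex matrix acting on the Kronecker product ℂ^d ⊗ ℂ^a, satisfying the conservation law V·(N_S ⊗ I_a + I_d ⊗ N_A) = (N_S ⊗ I_a + I_d ⊗ N_A)·V. Suppose (e_i)_{i=1}^d is an orthonormal basis of ℂ^d consisting of eigenvectors of L, φ₀ is a unit vector in ℂ^a, and (ξ_i)_{i=1}^d is an orthonormal family of vectors in ℂ^a such that V·(e_i ⊗ φ₀) = e_i ⊗ ξ_i for every i (an accurate and repeatable von Neumann–Lüders measurement of L). Then L·N_S = N_S·L. -/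
open Matrix Kronecker

lemma way_kron_form {d a : ℕ} (A : Matrix (Fin d) (Fin d) ℂ) (B : Matrix (Fin a) (Fin a) ℂ)
    (x z : Fin d → ℂ) (y w : Fin a → ℂ) :
    star (fun p : Fin d × Fin a => x p.1 * y p.2) ⬝ᵥ
      ((A ⊗ₖ B) *ᵥ (fun p : Fin d × Fin a => z p.1 * w p.2))
      = (star x ⬝ᵥ (A *ᵥ z)) * (star y ⬝ᵥ (B *ᵥ w)) := by
  have h : (A ⊗ₖ B) *ᵥ (fun p : Fin d × Fin a => z p.1 * w p.2)
      = fun p => (A *ᵥ z) p.1 * (B *ᵥ w) p.2 := by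
    funext p
    simp only [mulVec, dotProduct, kroneckerMap_apply, Fintype.sum_prod_type,
      Finset.sum_mul_sum]
    refine Finset.sum_congr rfl fun i _ => Finset.sum_congr rfl fun j _ => ?_
    ring
  rw [h]
  simp only [dotProduct, Fintype.sum_prod_type, Finset.sum_mul_sum, Pi.star_apply, star_mul']
  refine Finset.sum_congr rfl fun i _ => Finset.sum_congr rfl fun j _ => ?_
  ring

/-- **WAY theorem, repeatability version, finite dimensions.** -/
theorem way_repeatable (d a : ℕ) (hd : 0 < d) (ha : 0 < a)
    (L N_S : Matrix (Fin d) (Fin d) ℂ) (N_A : Matrix (Fin a) (Fin a) ℂ)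
    (hL : L.IsHermitian) (hNS : N_S.IsHermitian) (hNA : N_A.IsHermitian)
    (V : Matrix (Fin d × Fin a) (Fin d × Fin a) ℂ)
    (hV : V ∈ Matrix.unitaryGroup (Fin d × Fin a) ℂ)
    (hcons : V * (N_S ⊗ₖ (1 : Matrix (Fin a) (Fin a) ℂ)
        + (1 : Matrix (Fin d) (Fin d) ℂ) ⊗ₖ N_A)
      = (N_S ⊗ₖ (1 : Matrix (Fin a) (Fin a) ℂ)
        + (1 : Matrix (Fin d) (Fin d) ℂ) ⊗ₖ N_A) * V)
    (e : Fin d → (Fin d → ℂ)) (l : Fin d → ℝ)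
    (he_on : ∀ i j, star (e i) ⬝ᵥ e j = if i = j then 1 else 0)
    (he_eig : ∀ i, L.mulVec (e i) = (l i : ℂ) • e i)
    (φ₀ : Fin a → ℂ) (hφ : star φ₀ ⬝ᵥ φ₀ = 1)
    (ξ : Fin d → (Fin a → ℂ))
    (hξ_on : ∀ i j, star (ξ i) ⬝ᵥ ξ j = if i = j then 1 else 0)
    (hmeas : ∀ i, V.mulVec (fun p => e i p.1 * φ₀ p.2) = fun p => e i p.1 * ξ i p.2) :
    L * N_S = N_S * L := by
  have key : ∀ i j, i ≠ j → star (e i) ⬝ᵥ (N_S *ᵥ e j) = 0 := by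
    intro i j hij
    have hVV : Vᴴ * V = 1 := by
      have := (Matrix.mem_unitaryGroup_iff').1 hV
      simpa [Matrix.star_eq_conjTranspose] using this
    have inv : ∀ x y : Fin d × Fin a → ℂ, star (V *ᵥ x) ⬝ᵥ (V *ᵥ y) = star x ⬝ᵥ y := by
      intro x y
      rw [star_mulVec, dotProduct_mulVec, vecMul_vecMul, hVV, vecMul_one]
    have h1 := inv (fun p => e i p.1 * φ₀ p.2)
      ((N_S ⊗ₖ (1 : Matrix (Fin a) (Fin a) ℂ) + (1 : Matrix (Fin d) (Fin d) ℂ) ⊗ₖ N_A) *ᵥ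
        (fun p => e j p.1 * φ₀ p.2))
    rw [mulVec_mulVec, hcons, ← mulVec_mulVec, hmeas, hmeas, add_mulVec, add_mulVec,
      dotProduct_add, dotProduct_add, way_kron_form, way_kron_form, way_kron_form,
      way_kron_form] at h1
    simp only [one_mulVec, he_on, hξ_on, hφ, if_neg hij, zero_mul, mul_zero, add_zero,
      mul_one] at h1
    exact h1.symm
  let U : Matrix (Fin d) (Fin d) ℂ := Matrix.of fun p i => e i p
  have hU : Uᴴ * U = 1 := by
    ext i j
    rw [Matrix.one_apply, ← he_on i j]
    rfl
  have hU' : U * Uᴴ = 1 := mul_eq_one_comm.1 hU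
  have hLU : L * U = U * diagonal (fun i => (l i : ℂ)) := by
    ext p i
    rw [mul_diagonal]
    have := congrFun (he_eig i) p
    rw [Pi.smul_apply, smul_eq_mul, mul_comm] at this
    exact this
  have hNU : Uᴴ * (N_S * U) = diagonal (fun i => star (e i) ⬝ᵥ (N_S *ᵥ e i)) := by
    ext i j
    rw [diagonal_apply]
    split_ifs with h
    · subst h; rfl
    · exact key i j h
  have hL2 : L = U * diagonal (fun i => (l i : ℂ)) * Uᴴ := by
    rw [← hLU, Matrix.mul_assoc, hU', Matrix.mul_one]
  have hN2 : N_S = U * diagonal (fun i => star (e i) ⬝ᵥ (N_S *ᵥ e i)) * Uᴴ := by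
    rw [← hNU, ← Matrix.mul_assoc, hU', Matrix.one_mul, Matrix.mul_assoc, hU', Matrix.mul_one]
  have conj : ∀ D E : Matrix (Fin d) (Fin d) ℂ,
      (U * D * Uᴴ) * (U * E * Uᴴ) = U * (D * E) * Uᴴ := by
    intro D E
    calc (U * D * Uᴴ) * (U * E * Uᴴ) = U * D * (Uᴴ * U) * E * Uᴴ := by
          simp only [Matrix.mul_assoc]
      _ = U * (D * E) * Uᴴ := by rw [hU, Matrix.mul_one, Matrix.mul_assoc U D E]
  have hcomm : ∀ f g : Fin d → ℂ, diagonal f * diagonal g = diagonal g * diagonal f := by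
    intro f g
    simp only [diagonal_mul_diagonal, mul_comm]
  generalize (fun i => star (e i) ⬝ᵥ (N_S *ᵥ e i)) = f at hN2
  rw [hL2, hN2, conj, conj, hcomm]
end

section
/- (WAY theorem, Yanase-condition version, finite dimensions.) Let d, a be positive integers. Let L and N_S be Hermitian d×d complex matrices, N_A and Z_A Hermitian a×a complex matrices with Z_A·N_A = N_A·Z_A (the Yanase condition), and V a unitary (d·a)×(d·a) complex matrix on ℂ^d ⊗ ℂ^a satisfying V·(N_S ⊗ I_a + I_d ⊗ N_A) = (N_S ⊗ I_a + I_d ⊗ N_A)·V. Suppose (e_i)_{i=1}^d is an orthonormal basis of ℂ^d consisting of eigenvectors of L, φ₀ is a unit vector in ℂ^a, (z_i)_{i=1}^d are unit eigenvectors of Z_A whose Z_A-eigenvalues are pairwise distinct, and for each i there exists a vector χ_i ∈ ℂ^d with V·(e_i ⊗ φ₀) = χ_i ⊗ z_i (the pointer perfectly records the outcome). Then L·N_S = N_S·L. -/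
open Matrix Kronecker

theorem kron_mulVec_aux {d a : ℕ} (A : Matrix (Fin d) (Fin d) ℂ) (B : Matrix (Fin a) (Fin a) ℂ)
    (x : Fin d → ℂ) (y : Fin a → ℂ) :
    (A ⊗ₖ B) *ᵥ (fun p : Fin d × Fin a => x p.1 * y p.2)
      = fun p => (A *ᵥ x) p.1 * (B *ᵥ y) p.2 := by
  funext p
  simp only [mulVec, dotProduct, kroneckerMap_apply, Fintype.sum_prod_type, Finset.sum_mul_sum]
  refine Finset.sum_congr rfl fun i _ => Finset.sum_congr rfl fun j _ => by ring

theorem dot_aux {d a : ℕ} (u x : Fin d → ℂ) (v y : Fin a → ℂ) :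
    star (fun p : Fin d × Fin a => u p.1 * v p.2) ⬝ᵥ (fun p => x p.1 * y p.2)
      = (star u ⬝ᵥ x) * (star v ⬝ᵥ y) := by
  simp only [dotProduct, Fintype.sum_prod_type, Finset.sum_mul_sum, Pi.star_apply, star_mul']
  refine Finset.sum_congr rfl fun i _ => Finset.sum_congr rfl fun j _ => by ring

theorem form_aux {d a : ℕ} (A : Matrix (Fin d) (Fin d) ℂ) (B : Matrix (Fin a) (Fin a) ℂ)
    (u x : Fin d → ℂ) (v y : Fin a → ℂ) :
    star (fun p : Fin d × Fin a => u p.1 * v p.2) ⬝ᵥ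
      ((A ⊗ₖ (1 : Matrix (Fin a) (Fin a) ℂ) + (1 : Matrix (Fin d) (Fin d) ℂ) ⊗ₖ B) *ᵥ
        (fun p => x p.1 * y p.2))
      = (star u ⬝ᵥ (A *ᵥ x)) * (star v ⬝ᵥ y) + (star u ⬝ᵥ x) * (star v ⬝ᵥ (B *ᵥ y)) := by
  rw [add_mulVec, dotProduct_add, kron_mulVec_aux, kron_mulVec_aux, dot_aux, dot_aux,
    one_mulVec, one_mulVec]

theorem herm_aux {n : ℕ} {A : Matrix (Fin n) (Fin n) ℂ} (hA : A.IsHermitian)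
    {x : Fin n → ℂ} {r : ℝ} (hx : A *ᵥ x = (r : ℂ) • x) (y : Fin n → ℂ) :
    star x ⬝ᵥ (A *ᵥ y) = (r : ℂ) * (star x ⬝ᵥ y) := by
  rw [dotProduct_mulVec, ← hA.eq, ← star_mulVec, hx, star_smul, smul_dotProduct]
  simp

theorem orth_aux {n : ℕ} {A : Matrix (Fin n) (Fin n) ℂ} (hA : A.IsHermitian)
    {x y : Fin n → ℂ} {r s : ℝ} (hx : A *ᵥ x = (r : ℂ) • x) (hy : A *ᵥ y = (s : ℂ) • y)
    (h : r ≠ s) : star x ⬝ᵥ y = 0 := by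
  have h1 := herm_aux hA hx y
  rw [hy, dotProduct_smul, smul_eq_mul] at h1
  have h2 : ((r : ℂ) - s) * (star x ⬝ᵥ y) = 0 := by rw [sub_mul, h1]; ring
  refine (mul_eq_zero.mp h2).resolve_left ?_
  rw [sub_eq_zero]
  exact_mod_cast h

/-- **WAY theorem, Yanase-condition version, finite dimensions.** -/
theorem way_yanase (d a : ℕ) (hd : 0 < d) (ha : 0 < a)
    (L N_S : Matrix (Fin d) (Fin d) ℂ) (N_A Z_A : Matrix (Fin a) (Fin a) ℂ)
    (hL : L.IsHermitian) (hNS : N_S.IsHermitian) (hNA : N_A.IsHermitian)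
    (hZA : Z_A.IsHermitian)
    (hYanase : Z_A * N_A = N_A * Z_A)
    (V : Matrix (Fin d × Fin a) (Fin d × Fin a) ℂ)
    (hV : V ∈ Matrix.unitaryGroup (Fin d × Fin a) ℂ)
    (hcons : V * (N_S ⊗ₖ (1 : Matrix (Fin a) (Fin a) ℂ)
        + (1 : Matrix (Fin d) (Fin d) ℂ) ⊗ₖ N_A)
      = (N_S ⊗ₖ (1 : Matrix (Fin a) (Fin a) ℂ)
        + (1 : Matrix (Fin d) (Fin d) ℂ) ⊗ₖ N_A) * V)
    (e : Fin d → (Fin d → ℂ)) (l : Fin d → ℝ)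
    (he_on : ∀ i j, star (e i) ⬝ᵥ e j = if i = j then 1 else 0)
    (he_eig : ∀ i, L.mulVec (e i) = (l i : ℂ) • e i)
    (φ₀ : Fin a → ℂ) (hφ : star φ₀ ⬝ᵥ φ₀ = 1)
    (z : Fin d → (Fin a → ℂ)) (ζ : Fin d → ℝ)
    (hz_unit : ∀ i, star (z i) ⬝ᵥ z i = 1)
    (hz_eig : ∀ i, Z_A.mulVec (z i) = (ζ i : ℂ) • z i)
    (hz_distinct : Function.Injective ζ)
    (hmeas : ∀ i, ∃ χ : Fin d → ℂ,
      V.mulVec (fun p => e i p.1 * φ₀ p.2) = fun p => χ p.1 * z i p.2) :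
    L * N_S = N_S * L := by
  have hoff : ∀ i j, i ≠ j → star (e i) ⬝ᵥ (N_S *ᵥ e j) = 0 := by
    intro i j hij
    obtain ⟨χ, hχ⟩ := hmeas i
    obtain ⟨ξ, hξ⟩ := hmeas j
    have hz : ζ i ≠ ζ j := fun h => hij (hz_distinct h)
    have hz0 : star (z i) ⬝ᵥ z j = 0 := orth_aux hZA (hz_eig i) (hz_eig j) hz
    have hz1 : star (z i) ⬝ᵥ (N_A *ᵥ z j) = 0 := by
      refine orth_aux hZA (hz_eig i) ?_ hz
      rw [mulVec_mulVec, hYanase, ← mulVec_mulVec, hz_eig j, mulVec_smul]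
    have h1 := form_aux N_S N_A (e i) (e j) φ₀ φ₀
    have h2 := form_aux N_S N_A χ ξ (z i) (z j)
    rw [hz0, hz1, ← hχ, ← hξ, mulVec_mulVec, ← hcons, ← mulVec_mulVec, star_mulVec,
      ← dotProduct_mulVec, mulVec_mulVec, ← star_eq_conjTranspose,
      (Matrix.mem_unitaryGroup_iff').mp hV, one_mulVec, h1, hφ, he_on, if_neg hij] at h2
    simpa using h2
  have hE : (Matrix.of fun i j => e j i)ᴴ * (Matrix.of fun i j => e j i) = 1 := by
    ext i j
    rw [Matrix.one_apply, ← he_on i j]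
    rfl
  have hE' := mul_eq_one_comm.mp hE
  have key : (Matrix.of fun i j => e j i)ᴴ * ((L * N_S - N_S * L) *
      (Matrix.of fun i j => e j i)) = 0 := by
    ext i j
    change star (e i) ⬝ᵥ ((L * N_S - N_S * L) *ᵥ e j) = 0
    rw [sub_mulVec, dotProduct_sub, ← mulVec_mulVec, ← mulVec_mulVec, herm_aux hL (he_eig i),
      he_eig j, mulVec_smul, dotProduct_smul, smul_eq_mul]
    by_cases hij : i = j
    · subst hij; ring
    · rw [hoff i j hij]; ring
  rw [← sub_eq_zero]
  generalize L * N_S - N_S * L = X at key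
  generalize (Matrix.of fun i j => e j i) = E at key hE'
  calc X = (E * Eᴴ) * X * (E * Eᴴ) := by rw [hE', one_mul, mul_one]
    _ = E * (Eᴴ * (X * E)) * Eᴴ := by simp only [Matrix.mul_assoc]
    _ = 0 := by rw [key]; simp
end

section
/- (Purity of the twirled state forces an eigenstate of the conserved quantity.) Let d be a positive integer, n : Fin d → ℤ, N the diagonal d×d complex matrix with entries n_j, and T the U(1)-twirl defined by T(ρ)_{jk} = ρ_{jk} if n_j = n_k and 0 otherwise. Let e ∈ ℂ^d be a unit vector. If there exists a vector f ∈ ℂ^d such that T(e·e^*) = f·f^* (i.e., the twirl of the rank-one projector onto e is again a rank-one operator), then there exists an integer m such that N·e = m·e, i.e., e is an eigenvector of N. -/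
open Matrix

/-- The U(1)-twirl (dephasing map) with respect to the diagonal matrix with
integer entries `n j`. -/
noncomputable def twirl {d : ℕ} (n : Fin d → ℤ) (ρ : Matrix (Fin d) (Fin d) ℂ) :
    Matrix (Fin d) (Fin d) ℂ :=
  Matrix.of fun j k => if n j = n k then ρ j k else 0

/-- **Purity of the twirled state forces an eigenstate of the conserved quantity.**
If the twirl of the rank-one projector onto a unit vector `e` is again rank one,
then `e` is an eigenvector of `N = diagonal n`. -/
theorem twirl_pure_implies_eigenvector (d : ℕ) (hd : 0 < d) (n : Fin d → ℤ)
    (e : Fin d → ℂ) (he : star e ⬝ᵥ e = 1)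
    (hpure : ∃ f : Fin d → ℂ,
      twirl n (Matrix.vecMulVec e (star e)) = Matrix.vecMulVec f (star f)) :
    ∃ m : ℤ, (Matrix.diagonal fun j => (n j : ℂ)).mulVec e = (m : ℂ) • e := by
  obtain ⟨f, hf⟩ := hpure
  have hent : ∀ j k, (if n j = n k then e j * star (e k) else 0) = f j * star (f k) := by
    intro j k
    have h := congrFun (congrFun hf j) k
    simpa [twirl, Matrix.vecMulVec_apply] using h
  have hne : ∀ j, e j ≠ 0 → f j ≠ 0 := by
    intro j hj h0
    have h := hent j j
    simp [h0] at h
    exact hj h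
  have hex : ∃ j, e j ≠ 0 := by
    by_contra! hall
    have h0 : e = 0 := funext hall
    simp [h0] at he
  obtain ⟨j, hj⟩ := hex
  refine ⟨n j, ?_⟩
  ext k
  rw [Matrix.mulVec_diagonal, Pi.smul_apply, smul_eq_mul]
  by_cases hk : e k = 0
  · simp [hk]
  · have hnk : n k = n j := by
      by_contra hcon
      have h := hent k j
      rw [if_neg hcon] at h
      exact mul_ne_zero (hne k hk) (star_ne_zero.mpr (hne j hj)) h.symm
    rw [hnk]
end

section
/- (Covariance of the channel dilated by a conserving unitary and a charge eigenstate.) Let d, k be positive integers, n_S : Fin d → ℤ and n_K : Fin k → ℤ, and let N_S, N_K be the corresponding diagonal matrices. For θ ∈ ℝ let U_S(θ) = diag(exp(i·θ·n_S(j))). Let V be a unitary (d·k)×(d·k) complex matrix on ℂ^d ⊗ ℂ^k satisfying V·(N_S ⊗ I_k + I_d ⊗ N_K) = (N_S ⊗ I_k + I_d ⊗ N_K)·V, and let φ ∈ ℂ^k be a unit vector with N_K·φ = c·φ for some integer c. Define the linear map E on d×d complex matrices by E(ρ)_{j,j'} = Σ_{m=1}^k [V·(ρ ⊗ φ·φ^*)·V^*]_{(j,m),(j',m)}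 (the partial trace over the second factor). Then E is U(1)-covariant: for every θ ∈ ℝ and every d×d matrix ρ, E(U_S(θ)·ρ·U_S(θ)^*) = U_S(θ)·E(ρ)·U_S(θ)^*. -/
open Matrix Kronecker

/-- **Covariance of the channel dilated by a conserving unitary and a charge eigenstate.**
If `V` is a unitary commuting with `N_S ⊗ 1 + 1 ⊗ N_K` and `φ` is an eigenvector of `N_K`,
then the channel `ρ ↦ Tr_K[V (ρ ⊗ φφ^*) V^†]` is U(1)-covariant. -/
theorem dilated_channel_covariant (d k : ℕ) (hd : 0 < d) (hk : 0 < k)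
    (nS : Fin d → ℤ) (nK : Fin k → ℤ)
    (V : Matrix (Fin d × Fin k) (Fin d × Fin k) ℂ)
    (hV : V ∈ Matrix.unitaryGroup (Fin d × Fin k) ℂ)
    (hcons : V * (Matrix.diagonal (fun j => (nS j : ℂ)) ⊗ₖ (1 : Matrix (Fin k) (Fin k) ℂ)
        + (1 : Matrix (Fin d) (Fin d) ℂ) ⊗ₖ Matrix.diagonal (fun m => (nK m : ℂ)))
      = (Matrix.diagonal (fun j => (nS j : ℂ)) ⊗ₖ (1 : Matrix (Fin k) (Fin k) ℂ)
        + (1 : Matrix (Fin d) (Fin d) ℂ) ⊗ₖ Matrix.diagonal (fun m => (nK m : ℂ))) * V)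
    (φ : Fin k → ℂ) (hφ : star φ ⬝ᵥ φ = 1)
    (c : ℤ)
    (hφeig : (Matrix.diagonal fun m => (nK m : ℂ)).mulVec φ = (c : ℂ) • φ)
    (E : Matrix (Fin d) (Fin d) ℂ → Matrix (Fin d) (Fin d) ℂ)
    (hE : ∀ ρ, E ρ = Matrix.of fun j j' => ∑ m : Fin k,
        (V * (ρ ⊗ₖ Matrix.vecMulVec φ (star φ)) * Vᴴ) (j, m) (j', m))
    (θ : ℝ) (ρ : Matrix (Fin d) (Fin d) ℂ) :
    E ((Matrix.diagonal fun j => Complex.exp (Complex.I * (θ : ℂ) * (nS j : ℂ))) * ρ *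
        (Matrix.diagonal fun j => Complex.exp (Complex.I * (θ : ℂ) * (nS j : ℂ)))ᴴ)
      = (Matrix.diagonal fun j => Complex.exp (Complex.I * (θ : ℂ) * (nS j : ℂ))) * E ρ *
        (Matrix.diagonal fun j => Complex.exp (Complex.I * (θ : ℂ) * (nS j : ℂ)))ᴴ := by
  have hVz : ∀ j m a, V (j, m) a ≠ 0 → nS a.1 + nK a.2 = nS j + nK m := by
    intro j m a h
    have h1 : (Matrix.diagonal (fun j => (nS j : ℂ)) ⊗ₖ (1 : Matrix (Fin k) (Fin k) ℂ)
        + (1 : Matrix (Fin d) (Fin d) ℂ) ⊗ₖ Matrix.diagonal (fun m => (nK m : ℂ)))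
        = Matrix.diagonal (fun p : Fin d × Fin k => (nS p.1 : ℂ) + (nK p.2 : ℂ)) := by
      rw [← Matrix.diagonal_one, ← Matrix.diagonal_one, Matrix.diagonal_kronecker_diagonal,
        Matrix.diagonal_kronecker_diagonal, Matrix.diagonal_add]
      simp
    rw [h1] at hcons
    have h2 := congrFun (congrFun hcons (j, m)) a
    rw [Matrix.mul_diagonal, Matrix.diagonal_mul, mul_comm] at h2
    exact_mod_cast mul_right_cancel₀ h h2
  have hφz : ∀ m, φ m ≠ 0 → nK m = c := by
    intro m h
    have h2 := congrFun hφeig m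
    rw [Matrix.mulVec_diagonal] at h2
    simp only [Pi.smul_apply, smul_eq_mul] at h2
    exact_mod_cast mul_right_cancel₀ h h2
  set e : ℤ → ℂ := fun n => Complex.exp (Complex.I * (θ : ℂ) * (n : ℂ)) with he
  have hadd : ∀ a b, e (a + b) = e a * e b := by
    intro a b
    simp only [he]
    rw [← Complex.exp_add]
    push_cast
    ring_nf
  have hunit : ∀ a, e a * star (e a) = 1 := by
    intro a
    simp only [he, Complex.star_def]
    rw [← Complex.exp_conj, ← Complex.exp_add]
    simp
  have key : ∀ j m a, V (j, m) a * φ a.2 * e (nS a.1)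
      = V (j, m) a * φ a.2 * (e (nS j) * e (nK m - c)) := by
    intro j m a
    by_cases h : V (j, m) a = 0
    · simp [h]
    by_cases h' : φ a.2 = 0
    · simp [h']
    rw [← hadd]
    have h1 := hVz j m a h
    have h2 := hφz _ h'
    congr 2
    omega
  change E ((Matrix.diagonal fun j => e (nS j)) * ρ * (Matrix.diagonal fun j => e (nS j))ᴴ)
    = (Matrix.diagonal fun j => e (nS j)) * E ρ * (Matrix.diagonal fun j => e (nS j))ᴴ
  ext j j'
  rw [hE, hE, Matrix.diagonal_conjTranspose, Matrix.mul_diagonal, Matrix.diagonal_mul]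
  simp only [Matrix.of_apply, Finset.mul_sum, Finset.sum_mul, Matrix.mul_apply (M := V * _),
    Matrix.mul_apply (M := V)]
  refine Finset.sum_congr rfl fun m _ => Finset.sum_congr rfl fun b _ =>
    Finset.sum_congr rfl fun a _ => ?_
  obtain ⟨a1, a2⟩ := a
  obtain ⟨b1, b2⟩ := b
  have ka := key j m (a1, a2)
  have kb := congrArg star (key j' m (b1, b2))
  have hz := hunit (nK m - c)
  simp only [Matrix.kroneckerMap_apply, Matrix.mul_diagonal, Matrix.diagonal_mul,
    Matrix.vecMulVec_apply, Matrix.conjTranspose_apply, Pi.star_apply, star_mul'] at ka kb ⊢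
  calc _ = ρ a1 b1 * (V (j, m) (a1, a2) * φ a2 * e (nS a1)) *
        (star (V (j', m) (b1, b2)) * star (φ b2) * star (e (nS b1))) := by ring
    _ = ρ a1 b1 * (V (j, m) (a1, a2) * φ a2) * (star (V (j', m) (b1, b2)) * star (φ b2)) *
        (e (nS j) * star (e (nS j'))) * (e (nK m - c) * star (e (nK m - c))) := by
          rw [ka, kb]; ring
    _ = _ := by rw [hz]; ring
end

section
/- (Core lemma of the resource-theoretic WAY proof.) Let d be a positive integer, n : Fin d → ℤ, N the diagonal d×d complex matrix with entries n_j, and T the U(1)-twirl defined by T(ρ)_{jk} = ρ_{jk} if n_j = n_k and 0 otherwise. Let L be a Hermitian d×d complex matrix with an orthonormal eigenbasis (e_i)_{i=1}^d. If the twirled eigenprojectors have pairwise orthogonal supports, i.e., T(e_i·e_i^*) · T(e_j·e_j^*) = 0 for all i ≠ j, then L·N = N·L. (Consequently, perfect unambiguous discrimination of the twirled eigenstate ensemble, and hence a perfect von Neumann–Lüders measurement of L under the conservation of N, is possible only when L commutes with N.) -/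
open Matrix

/-- **Core lemma of the resource-theoretic WAY proof.** If the twirled eigenprojectors
of a Hermitian observable `L` have pairwise orthogonal supports, then `L` commutes with
the conserved quantity `N = diagonal n`. -/
theorem way_core_lemma (d : ℕ) (hd : 0 < d) (n : Fin d → ℤ)
    (L : Matrix (Fin d) (Fin d) ℂ) (hL : L.IsHermitian)
    (e : Fin d → (Fin d → ℂ)) (l : Fin d → ℝ)
    (he_on : ∀ i j, star (e i) ⬝ᵥ e j = if i = j then 1 else 0)
    (he_eig : ∀ i, L.mulVec (e i) = (l i : ℂ) • e i)
    (horth : ∀ i j, i ≠ j →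
      twirl n (Matrix.vecMulVec (e i) (star (e i))) *
        twirl n (Matrix.vecMulVec (e j) (star (e j))) = 0) :
    L * Matrix.diagonal (fun j => (n j : ℂ)) = Matrix.diagonal (fun j => (n j : ℂ)) * L := by
  have hS : ∀ i j, i ≠ j → ∀ m : ℤ,
      ∑ k with n k = m, star (e i k) * e j k = 0 := by
    intro i j hij m
    by_contra hne
    obtain ⟨k, hk, hk0⟩ := Finset.exists_ne_zero_of_sum_ne_zero hne
    have hkm : n k = m := (Finset.mem_filter.mp hk).2
    have h := congrFun (congrFun (horth i j hij) k) k
    rw [Matrix.zero_apply] at h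
    have h2 : e i k * (∑ k with n k = m, star (e i k) * e j k) * star (e j k) = 0 := by
      rw [← h, Matrix.mul_apply, Finset.mul_sum, Finset.sum_mul, Finset.sum_filter]
      refine Finset.sum_congr rfl fun x _ => ?_
      by_cases hx : n x = m
      · simp [twirl, Matrix.vecMulVec_apply, hx, hkm]
        ring
      · have hx' : ¬ m = n x := fun h => hx h.symm
        simp [twirl, hx, hx', hkm]
    have h3 : e i k ≠ 0 := fun h0 => hk0 (by simp [h0])
    have h4 : e j k ≠ 0 := fun h0 => hk0 (by simp [h0])
    exact mul_ne_zero (mul_ne_zero h3 hne) (star_ne_zero.mpr h4) h2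
  have hN : ∀ i j, i ≠ j → ∑ k, star (e i k) * ((n k : ℂ) * e j k) = 0 := by
    intro i j hij
    rw [← Finset.sum_fiberwise_of_maps_to (t := Finset.univ.image n) (g := n)
      (fun k _ => Finset.mem_image_of_mem n (Finset.mem_univ k))]
    refine Finset.sum_eq_zero fun m _ => ?_
    have : ∑ k with n k = m, star (e i k) * ((n k : ℂ) * e j k)
        = (m : ℂ) * ∑ k with n k = m, star (e i k) * e j k := by
      rw [Finset.mul_sum]
      refine Finset.sum_congr rfl fun k hk => ?_
      rw [(Finset.mem_filter.mp hk).2]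
      ring
    rw [this, hS i j hij m, mul_zero]
  set N : Matrix (Fin d) (Fin d) ℂ := Matrix.diagonal (fun j => (n j : ℂ)) with hNdef
  let U : Matrix (Fin d) (Fin d) ℂ := Matrix.of fun k i => e i k
  have hU : Uᴴ * U = 1 := by
    ext i j
    have := he_on i j
    simpa [Matrix.mul_apply, U, dotProduct, Matrix.one_apply] using this
  have hU' : U * Uᴴ = 1 := mul_eq_one_comm.mp hU
  have hLU : L * U = U * Matrix.diagonal (fun i => (l i : ℂ)) := by
    ext k i
    have := congrFun (he_eig i) k
    rw [Matrix.mul_diagonal]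
    simpa [Matrix.mul_apply, U, Matrix.mulVec, dotProduct, mul_comm] using this
  obtain ⟨D, hD⟩ : ∃ D : Fin d → ℂ, Uᴴ * (N * U) = Matrix.diagonal D := by
    refine ⟨fun i => (Uᴴ * (N * U)) i i, ?_⟩
    ext i j
    by_cases hij : i = j
    · subst hij; simp
    · rw [Matrix.diagonal_apply_ne _ hij, ← hN i j hij, Matrix.mul_apply]
      refine Finset.sum_congr rfl fun k _ => ?_
      rw [hNdef, Matrix.diagonal_mul]
      simp [U]
  have hNU : N * U = U * Matrix.diagonal D := by
    rw [← hD, ← Matrix.mul_assoc, hU', Matrix.one_mul]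
  have key : L * N * U = N * L * U := by
    rw [Matrix.mul_assoc, hNU, ← Matrix.mul_assoc, hLU, Matrix.mul_assoc N, hLU,
      ← Matrix.mul_assoc N, hNU, Matrix.mul_assoc, Matrix.mul_assoc,
      Matrix.diagonal_mul_diagonal, Matrix.diagonal_mul_diagonal]
    simp only [mul_comm]
  calc L * N = L * N * U * Uᴴ := by rw [Matrix.mul_assoc _ U, hU', Matrix.mul_one]
    _ = N * L := by rw [key, Matrix.mul_assoc _ U, hU', Matrix.mul_one]
end

section
/- (The measurement circuit unitary exists, conserves the charge, and records the outcome.) Let M ≥ 1 and work on H = ℂ^{M+1} ⊗ ℂ² ⊗ ℂ² ⊗ ℂ² ⊗ ℂ², with standard basis |j, s, a, b, c⟩ for j ∈ {0,…,M}, s,a,b,c ∈ {0,1}. Let φ_n^± = (1/√2)(|n,0⟩±|n−1,1⟩) ∈ ℂ^{M+1}⊗ℂ², Π_0 = |0,0⟩⟨0,0| + |M,1⟩⟨M,1|, Π_± = Σ_{n=1}^M |φ_n^±⟩⟨φ_n^±|, and let S_{13}, S_{23} be the unitaries on ℂ²⊗ℂ²⊗ℂ² that swap the first and third, respectively second and third,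 tensor factors. Define V = Π_0 ⊗ I_8 + Π_- ⊗ S_{23} + Π_+ ⊗ S_{13}. Then: (i) V is unitary; (ii) V commutes with the diagonal total-number operator N_tot whose diagonal entry at (j,s,a,b,c) is j+s+a+b+c; and (iii) V·(φ_n^+ ⊗ |0,0,1⟩) = φ_n^+ ⊗ |1,0,0⟩ and V·(φ_n^- ⊗ |0,0,1⟩) = φ_n^- ⊗ |0,1,0⟩ for every n = 1,…,M, while V acts as the identity on (range Π_0) ⊗ ℂ^8. -/
open Matrix Kronecker

/-- Standard basis vector `|x⟩`. -/
noncomputable def ket {ι : Type*} [DecidableEq ι] (x : ι) : ι → ℂ :=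
  fun p => if p = x then 1 else 0


theorem aux_ket_dot {ι : Type*} [DecidableEq ι] [Fintype ι] (x y : ι) :
    star (ket x) ⬝ᵥ ket y = if x = y then 1 else 0 := by
  simp [dotProduct, ket, eq_comm]

theorem aux_star_ket {ι : Type*} [DecidableEq ι] (x : ι) : star (ket x) = ket x := by
  funext p
  simp only [ket, Pi.star_apply]
  split_ifs <;> simp

theorem aux_herm {ι : Type*} (v : ι → ℂ) :
    (vecMulVec v (star v))ᴴ = vecMulVec v (star v) := by
  ext p q
  simp [vecMulVec_apply, mul_comm]

theorem aux_mulVec {ι : Type*} [Fintype ι] (v w : ι → ℂ) :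
    vecMulVec v (star v) *ᵥ w = (star v ⬝ᵥ w) • v := by
  funext p
  simp only [mulVec, dotProduct, vecMulVec_apply, Pi.smul_apply, smul_eq_mul, Finset.sum_mul]
  exact Finset.sum_congr rfl fun _ _ => by ring

theorem aux_mul {ι : Type*} [Fintype ι] (A : Matrix ι ι ℂ) (v w : ι → ℂ) :
    A * vecMulVec v w = vecMulVec (A *ᵥ v) w := by
  ext p q
  simp only [mul_apply, mulVec, dotProduct, vecMulVec_apply, Finset.sum_mul]
  exact Finset.sum_congr rfl fun _ _ => by ring

theorem aux_comm {ι : Type*} [Fintype ι] [DecidableEq ι] (d : ι → ℂ) (hd : ∀ p, star (d p) = d p)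
    (c : ℂ) (hc : star c = c) (v : ι → ℂ) (h : ∀ p, d p * v p = c * v p) :
    vecMulVec v (star v) * diagonal d = diagonal d * vecMulVec v (star v) := by
  ext p q
  rw [mul_diagonal, diagonal_mul]
  simp only [vecMulVec_apply, Pi.star_apply]
  have h2 := congrArg star (h q)
  simp only [star_mul', hd, hc] at h2
  linear_combination v p * h2 - star (v q) * h p

theorem aux_kron {α β : Type*} [Fintype α] [Fintype β] (A : Matrix α α ℂ) (B : Matrix β β ℂ)
    (u : α → ℂ) (r : β → ℂ) :
    (A ⊗ₖ B) *ᵥ (fun p => u p.1 * r p.2) = fun p => (A *ᵥ u) p.1 * (B *ᵥ r) p.2 := by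
  funext p
  simp only [mulVec, dotProduct, kroneckerMap_apply, Fintype.sum_prod_type, Finset.sum_mul_sum]
  exact Finset.sum_congr rfl fun _ _ => Finset.sum_congr rfl fun _ _ => by ring

theorem aux_complete {ι : Type*} [Fintype ι] [DecidableEq ι] :
    ∑ x : ι, vecMulVec (ket x) (star (ket x)) = 1 := by
  ext p q
  simp only [Matrix.sum_apply, vecMulVec_apply, aux_star_ket]
  simp [ket, one_apply]

/-- **The measurement circuit unitary exists, conserves the charge, and records the
outcome.** With `V = P0 ⊗ I₈ + Π₋ ⊗ S₂₃ + Π₊ ⊗ S₁₃`: (i) `V` is unitary, (ii) `V`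
commutes with the diagonal total-number operator, and (iii) `V` records `±` outcomes
in the register and acts as the identity on `(range P0) ⊗ ℂ⁸`. -/
theorem measurement_circuit_unitary (M : ℕ) (hM : 1 ≤ M)
    (φp φm : Fin M → (Fin (M+1) × Fin 2 → ℂ))
    (hφp : ∀ i : Fin M, φp i = fun p =>
      ((Real.sqrt 2 : ℝ)⁻¹ : ℂ) * (ket ((i.succ, (0 : Fin 2)) : Fin (M+1) × Fin 2) p
        + ket ((i.castSucc, (1 : Fin 2)) : Fin (M+1) × Fin 2) p))
    (hφm : ∀ i : Fin M, φm i = fun p =>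
      ((Real.sqrt 2 : ℝ)⁻¹ : ℂ) * (ket ((i.succ, (0 : Fin 2)) : Fin (M+1) × Fin 2) p
        - ket ((i.castSucc, (1 : Fin 2)) : Fin (M+1) × Fin 2) p))
    (P0 Pp Pm : Matrix (Fin (M+1) × Fin 2) (Fin (M+1) × Fin 2) ℂ)
    (hP0 : P0 = Matrix.vecMulVec (ket (((0 : Fin (M+1)), (0 : Fin 2)) : Fin (M+1) × Fin 2))
        (star (ket (((0 : Fin (M+1)), (0 : Fin 2)) : Fin (M+1) × Fin 2)))
      + Matrix.vecMulVec (ket ((Fin.last M, (1 : Fin 2)) : Fin (M+1) × Fin 2))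
        (star (ket ((Fin.last M, (1 : Fin 2)) : Fin (M+1) × Fin 2))))
    (hPp : Pp = ∑ i : Fin M, Matrix.vecMulVec (φp i) (star (φp i)))
    (hPm : Pm = ∑ i : Fin M, Matrix.vecMulVec (φm i) (star (φm i)))
    (S13 S23 : Matrix (Fin 2 × Fin 2 × Fin 2) (Fin 2 × Fin 2 × Fin 2) ℂ)
    (hS13 : S13 = Matrix.of fun x y =>
      if x.1 = y.2.2 ∧ x.2.1 = y.2.1 ∧ x.2.2 = y.1 then 1 else 0)
    (hS23 : S23 = Matrix.of fun x y =>
      if x.1 = y.1 ∧ x.2.1 = y.2.2 ∧ x.2.2 = y.2.1 then 1 else 0)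
    (V : Matrix ((Fin (M+1) × Fin 2) × (Fin 2 × Fin 2 × Fin 2))
        ((Fin (M+1) × Fin 2) × (Fin 2 × Fin 2 × Fin 2)) ℂ)
    (hV : V = P0 ⊗ₖ (1 : Matrix (Fin 2 × Fin 2 × Fin 2) (Fin 2 × Fin 2 × Fin 2) ℂ)
      + Pm ⊗ₖ S23 + Pp ⊗ₖ S13)
    (Ntot : Matrix ((Fin (M+1) × Fin 2) × (Fin 2 × Fin 2 × Fin 2))
        ((Fin (M+1) × Fin 2) × (Fin 2 × Fin 2 × Fin 2)) ℂ)
    (hNtot : Ntot = Matrix.diagonal fun p =>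
      (((p.1.1 : ℕ) + (p.1.2 : ℕ) + (p.2.1 : ℕ) + (p.2.2.1 : ℕ) + (p.2.2.2 : ℕ) : ℕ) : ℂ)) :
    V ∈ Matrix.unitaryGroup ((Fin (M+1) × Fin 2) × (Fin 2 × Fin 2 × Fin 2)) ℂ ∧
    V * Ntot = Ntot * V ∧
    (∀ i : Fin M,
      V.mulVec (fun p => φp i p.1 *
          ket (((0 : Fin 2), (0 : Fin 2), (1 : Fin 2)) : Fin 2 × Fin 2 × Fin 2) p.2)
        = (fun p => φp i p.1 *
          ket (((1 : Fin 2), (0 : Fin 2), (0 : Fin 2)) : Fin 2 × Fin 2 × Fin 2) p.2) ∧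
      V.mulVec (fun p => φm i p.1 *
          ket (((0 : Fin 2), (0 : Fin 2), (1 : Fin 2)) : Fin 2 × Fin 2 × Fin 2) p.2)
        = (fun p => φm i p.1 *
          ket (((0 : Fin 2), (1 : Fin 2), (0 : Fin 2)) : Fin 2 × Fin 2 × Fin 2) p.2)) ∧
    (∀ (u : Fin (M+1) × Fin 2 → ℂ) (r : Fin 2 × Fin 2 × Fin 2 → ℂ),
      P0.mulVec u = u →
      V.mulVec (fun p => u p.1 * r p.2) = fun p => u p.1 * r p.2) := by
  have hs : ((Real.sqrt 2 : ℝ)⁻¹ : ℂ) * ((Real.sqrt 2 : ℝ)⁻¹ : ℂ) = 1 / 2 := by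
    rw [← mul_inv, ← Complex.ofReal_mul, Real.mul_self_sqrt (by norm_num)]
    norm_num
  have hss : star ((Real.sqrt 2 : ℝ)⁻¹ : ℂ) = ((Real.sqrt 2 : ℝ)⁻¹ : ℂ) := by
    simp
  generalize ((Real.sqrt 2 : ℝ)⁻¹ : ℂ) = s at *
  have hφp' : ∀ i, φp i = s • (ket (i.succ, (0 : Fin 2)) + ket (i.castSucc, (1 : Fin 2))) :=
    fun i => by rw [hφp]; rfl
  have hφm' : ∀ i, φm i = s • (ket (i.succ, (0 : Fin 2)) - ket (i.castSucc, (1 : Fin 2))) :=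
    fun i => by rw [hφm]; rfl
  have dpp : ∀ i j, star (φp i) ⬝ᵥ φp j = if i = j then 1 else 0 := by
    intro i j
    rw [hφp', hφp']
    simp only [star_smul, star_add, smul_dotProduct, dotProduct_smul, add_dotProduct,
      dotProduct_add, aux_ket_dot, hss, smul_eq_mul, ← mul_assoc, hs]
    by_cases h : i = j <;> simp [h]
    linear_combination 2 * hs
  have dmm : ∀ i j, star (φm i) ⬝ᵥ φm j = if i = j then 1 else 0 := by
    intro i j
    rw [hφm', hφm']
    simp only [star_smul, star_sub, smul_dotProduct, dotProduct_smul, sub_dotProduct,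
      dotProduct_sub, aux_ket_dot, hss, smul_eq_mul, ← mul_assoc, hs]
    by_cases h : i = j <;> simp [h]
    linear_combination 2 * hs
  have dpm : ∀ i j, star (φp i) ⬝ᵥ φm j = 0 := by
    intro i j
    rw [hφp', hφm']
    simp only [star_smul, star_add, smul_dotProduct, dotProduct_smul, add_dotProduct,
      dotProduct_sub, aux_ket_dot, hss, smul_eq_mul, ← mul_assoc, hs]
    by_cases h : i = j <;> simp [h]
  have dmp : ∀ i j, star (φm i) ⬝ᵥ φp j = 0 := by
    intro i j
    rw [hφm', hφp']
    simp only [star_smul, star_sub, smul_dotProduct, dotProduct_smul, sub_dotProduct,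
      dotProduct_add, aux_ket_dot, hss, smul_eq_mul, ← mul_assoc, hs]
    by_cases h : i = j <;> simp [h]
  have h0 : ∀ i : Fin M, (0 : Fin (M+1)) ≠ i.succ := fun i => (Fin.succ_ne_zero i).symm
  have hl : ∀ i : Fin M, Fin.last M ≠ i.castSucc := fun i => (Fin.castSucc_lt_last i).ne'
  have P0p : ∀ i, P0 *ᵥ φp i = 0 := by
    intro i
    rw [hP0, add_mulVec, aux_mulVec, aux_mulVec, hφp']
    simp [dotProduct_add, aux_ket_dot, h0, hl]
  have P0m : ∀ i, P0 *ᵥ φm i = 0 := by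
    intro i
    rw [hP0, add_mulVec, aux_mulVec, aux_mulVec, hφm']
    simp [dotProduct_sub, aux_ket_dot, h0, hl]
  have Ppp : ∀ i, Pp *ᵥ φp i = φp i := by
    intro i
    rw [hPp, sum_mulVec]
    simp [aux_mulVec, dpp]
  have Ppm : ∀ i, Pp *ᵥ φm i = 0 := by
    intro i
    rw [hPp, sum_mulVec]
    simp [aux_mulVec, dpm]
  have Pmm : ∀ i, Pm *ᵥ φm i = φm i := by
    intro i
    rw [hPm, sum_mulVec]
    simp [aux_mulVec, dmm]
  have Pmp : ∀ i, Pm *ᵥ φp i = 0 := by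
    intro i
    rw [hPm, sum_mulVec]
    simp [aux_mulVec, dmp]
  have H0 : P0ᴴ = P0 := by rw [hP0, conjTranspose_add, aux_herm, aux_herm]
  have Hp : Ppᴴ = Pp := by rw [hPp, conjTranspose_sum]; simp only [aux_herm]
  have Hm : Pmᴴ = Pm := by rw [hPm, conjTranspose_sum]; simp only [aux_herm]
  have zv : ∀ w : Fin (M+1) × Fin 2 → ℂ,
      vecMulVec (0 : Fin (M+1) × Fin 2 → ℂ) w = 0 := fun w => by
    ext; simp [vecMulVec_apply]
  have Mpp : Pp * Pp = Pp := by
    have e : Pp * (∑ i : Fin M, vecMulVec (φp i) (star (φp i)))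
        = ∑ i : Fin M, vecMulVec (φp i) (star (φp i)) := by
      rw [Finset.mul_sum]
      simp only [aux_mul, Ppp]
    rwa [← hPp] at e
  have Mmm : Pm * Pm = Pm := by
    have e : Pm * (∑ i : Fin M, vecMulVec (φm i) (star (φm i)))
        = ∑ i : Fin M, vecMulVec (φm i) (star (φm i)) := by
      rw [Finset.mul_sum]
      simp only [aux_mul, Pmm]
    rwa [← hPm] at e
  have Mpm : Pp * Pm = 0 := by
    rw [hPm, Finset.mul_sum]
    simp only [aux_mul, Ppm, zv, Finset.sum_const_zero]
  have Mmp : Pm * Pp = 0 := by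
    rw [hPp, Finset.mul_sum]
    simp only [aux_mul, Pmp, zv, Finset.sum_const_zero]
  have M0p : P0 * Pp = 0 := by
    rw [hPp, Finset.mul_sum]
    simp only [aux_mul, P0p, zv, Finset.sum_const_zero]
  have M0m : P0 * Pm = 0 := by
    rw [hPm, Finset.mul_sum]
    simp only [aux_mul, P0m, zv, Finset.sum_const_zero]
  have Mp0 : Pp * P0 = 0 := by
    have := congrArg conjTranspose M0p
    rwa [conjTranspose_mul, H0, Hp, conjTranspose_zero] at this
  have Mm0 : Pm * P0 = 0 := by
    have := congrArg conjTranspose M0m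
    rwa [conjTranspose_mul, H0, Hm, conjTranspose_zero] at this
  have Pone : P0 + Pm + Pp = 1 := by
    have e : Pm + Pp = ∑ i : Fin M,
        (vecMulVec (ket (i.succ, (0 : Fin 2))) (star (ket (i.succ, (0 : Fin 2))))
        + vecMulVec (ket (i.castSucc, (1 : Fin 2))) (star (ket (i.castSucc, (1 : Fin 2))))) := by
      rw [hPm, hPp, ← Finset.sum_add_distrib]
      refine Finset.sum_congr rfl fun i _ => ?_
      rw [hφp', hφm']
      simp only [star_smul, star_add, star_sub, hss, aux_star_ket]
      ext p q
      simp only [Matrix.add_apply, vecMulVec_apply, Pi.smul_apply, Pi.add_apply, Pi.sub_apply,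
        smul_eq_mul]
      linear_combination (2 * (ket (i.succ, (0 : Fin 2)) p * ket (i.succ, (0 : Fin 2)) q
        + ket (i.castSucc, (1 : Fin 2)) p * ket (i.castSucc, (1 : Fin 2)) q)) * hs
    rw [add_assoc, e, hP0, ← aux_complete, Fintype.sum_prod_type_right, Fin.sum_univ_two,
      Fin.sum_univ_succ, Fin.sum_univ_castSucc (n := M), Finset.sum_add_distrib]
    abel
  have M00 : P0 * P0 = P0 := by
    have := congrArg (P0 * ·) Pone
    simpa [mul_add, M0m, M0p] using this
  have T13 : S13ᴴ = S13 := by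
    rw [hS13]; ext x y
    simp only [conjTranspose_apply, of_apply]
    split_ifs <;> first | (simp; done) | (exfalso; grind)
  have T23 : S23ᴴ = S23 := by
    rw [hS23]; ext x y
    simp only [conjTranspose_apply, of_apply]
    split_ifs <;> first | (simp; done) | (exfalso; grind)
  have S13v : ∀ r x, (S13 *ᵥ r) x = r (x.2.2, x.2.1, x.1) := by
    intro r x
    rw [hS13]
    simp only [mulVec, dotProduct, of_apply]
    rw [Finset.sum_eq_single (x.2.2, x.2.1, x.1)]
    · simp
    · rintro ⟨a, b, c⟩ _ h
      rw [if_neg, zero_mul]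
      rintro ⟨h1, h2, h3⟩
      exact h (by simp_all)
    · simp
  have S23v : ∀ r x, (S23 *ᵥ r) x = r (x.1, x.2.2, x.2.1) := by
    intro r x
    rw [hS23]
    simp only [mulVec, dotProduct, of_apply]
    rw [Finset.sum_eq_single (x.1, x.2.2, x.2.1)]
    · simp
    · rintro ⟨a, b, c⟩ _ h
      rw [if_neg, zero_mul]
      rintro ⟨h1, h2, h3⟩
      exact h (by simp_all)
    · simp
  have Q13 : S13 * S13 = 1 := by
    apply Matrix.mulVec_injective
    funext r x
    rw [← mulVec_mulVec, S13v, S13v, one_mulVec]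
  have Q23 : S23 * S23 = 1 := by
    apply Matrix.mulVec_injective
    funext r x
    rw [← mulVec_mulVec, S23v, S23v, one_mulVec]
  have Vmul : ∀ u r, V *ᵥ (fun p => u p.1 * r p.2) = fun p =>
      (P0 *ᵥ u) p.1 * r p.2 + (Pm *ᵥ u) p.1 * (S23 *ᵥ r) p.2
        + (Pp *ᵥ u) p.1 * (S13 *ᵥ r) p.2 := by
    intro u r
    rw [hV, add_mulVec, add_mulVec, aux_kron, aux_kron, aux_kron, one_mulVec]
    rfl
  refine ⟨?_, ?_, ?_, ?_⟩
  · rw [mem_unitaryGroup_iff, star_eq_conjTranspose]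
    have hVH : Vᴴ = V := by
      rw [hV]
      simp only [conjTranspose_add, conjTranspose_kronecker, H0, Hp, Hm, T13, T23,
        conjTranspose_one]
    rw [hVH, hV]
    simp only [add_mul, mul_add, ← mul_kronecker_mul, M00, M0p, M0m, Mp0, Mm0, Mpp, Mpm, Mmp, Mmm,
      Q13, Q23, zero_kronecker, mul_one, add_zero, zero_add]
    rw [← add_kronecker, ← add_kronecker, Pone, one_kronecker_one]
  · let d1 : Fin (M+1) × Fin 2 → ℂ := fun p => (((p.1 : ℕ) + (p.2 : ℕ) : ℕ) : ℂ)
    let d2 : Fin 2 × Fin 2 × Fin 2 → ℂ := fun p => (((p.1 : ℕ) + (p.2.1 : ℕ) + (p.2.2 : ℕ) : ℕ) : ℂ)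
    have hd1 : ∀ p, star (d1 p) = d1 p := fun p => by simp [d1]
    have hN : Ntot = diagonal d1 ⊗ₖ 1 + 1 ⊗ₖ diagonal d2 := by
      rw [hNtot]
      rw [← diagonal_one, ← diagonal_one, diagonal_kronecker_diagonal, diagonal_kronecker_diagonal,
        diagonal_add]
      congr 1
      funext p
      simp only [d1, d2]
      push_cast
      ring
    have kd : ∀ (x : Fin (M+1) × Fin 2) p, d1 p * ket x p = d1 x * ket x p := by
      intro x p
      simp only [ket]
      split_ifs with h
      · rw [h]
      · simp
    have e1 : ∀ i : Fin M, d1 (i.castSucc, 1) = d1 (i.succ, 0) := fun i => by simp [d1]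
    have C0 : P0 * diagonal d1 = diagonal d1 * P0 := by
      rw [hP0, add_mul, mul_add, aux_comm d1 hd1 _ (hd1 _) _ (kd _),
        aux_comm d1 hd1 _ (hd1 _) _ (kd _)]
    have Cp : Pp * diagonal d1 = diagonal d1 * Pp := by
      rw [hPp, Finset.sum_mul, Finset.mul_sum]
      refine Finset.sum_congr rfl fun i _ => aux_comm d1 hd1 _ (hd1 (i.succ, 0)) _ fun p => ?_
      have a := kd (i.succ, 0) p
      have b := kd (i.castSucc, 1) p
      rw [e1] at b
      rw [hφp]
      linear_combination s * a + s * b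
    have Cm : Pm * diagonal d1 = diagonal d1 * Pm := by
      rw [hPm, Finset.sum_mul, Finset.mul_sum]
      refine Finset.sum_congr rfl fun i _ => aux_comm d1 hd1 _ (hd1 (i.succ, 0)) _ fun p => ?_
      have a := kd (i.succ, 0) p
      have b := kd (i.castSucc, 1) p
      rw [e1] at b
      rw [hφm]
      linear_combination s * a - s * b
    have C13 : S13 * diagonal d2 = diagonal d2 * S13 := by
      rw [hS13]
      ext x y
      rw [mul_diagonal, diagonal_mul]
      simp only [of_apply]
      split_ifs with h
      · simp only [d2, h.1, h.2.1, h.2.2]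
        push_cast
        ring
      · simp
    have C23 : S23 * diagonal d2 = diagonal d2 * S23 := by
      rw [hS23]
      ext x y
      rw [mul_diagonal, diagonal_mul]
      simp only [of_apply]
      split_ifs with h
      · simp only [d2, h.1, h.2.1, h.2.2]
        push_cast
        ring
      · simp
    rw [hV, hN]
    simp only [add_mul, mul_add, ← mul_kronecker_mul, one_mul, mul_one, C0, Cp, Cm, C13, C23]
    abel
  · intro i
    constructor
    · rw [Vmul, P0p, Pmp, Ppp]
      funext ⟨x, a, b, c⟩
      rw [S13v]
      simp only [Pi.zero_apply, zero_mul, zero_add, ket, Prod.mk.injEq]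
      congr 2
      apply propext
      tauto
    · rw [Vmul, P0m, Ppm, Pmm]
      funext ⟨x, a, b, c⟩
      rw [S23v]
      simp only [Pi.zero_apply, zero_mul, zero_add, add_zero, ket, Prod.mk.injEq]
      congr 2
      apply propext
      tauto
  · intro u r hu
    have a : Pp *ᵥ u = 0 := by rw [← hu, mulVec_mulVec, Mp0, zero_mulVec]
    have b : Pm *ᵥ u = 0 := by rw [← hu, mulVec_mulVec, Mm0, zero_mulVec]
    rw [Vmul, a, b, hu]
    simp
end
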